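/- In terms of the splitting of first-order multidifferential operators, the Nijenhuis–Richardson bracket is given by: for all multiderivations A_1 ∈ ADer^a(V), A_2 ∈ ADer^{a−1}(V), B_1 ∈ ADer^b(V), B_2 ∈ ADer^{b−1}(V), [A_1 + I∧A_2, B_1 + I∧B_2]^{NR} = [A_1,B_1]^{NR} + (−1)^a I∧[A_1,B_2]^{NR} + I∧[A_2,B_1]^{NR} + a·A_1∧B_2 − (−1)^a b·A_2∧B_1 + (a−b)·I∧A_2∧B_2. -/

import Mathlib

/-!  Common framework: operations of degree `a ≥ -1` on a vector space `V`
(i.e. `(a+1)`-linear maps `V^{a+1} → V`) are encoded as raw functions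
`(ℕ → V) → V` depending only on the first `a+1` entries of the argument
sequence, together with explicit multilinearity/alternation predicates. -/

noncomputable section
open scoped Classical

namespace JacobiRevisited

/-- Raw operations on `V`: an `n`-ary operation is encoded by its action on
infinite sequences of arguments (using only the first `n` of them). -/
abbrev Op (V : Type*) := (ℕ → V) → V

/-- `A` depends only on the first `n` arguments. -/
def DependsOn {V : Type*} (n : ℕ) (A : Op V) : Prop :=
  ∀ x y : ℕ → V, (∀ i, i < n → x i = y i) → A x = A y

/-- `A` is an `n`-linear map `V^n → V` (encoded on sequences): it depends only on
the first `n` arguments and is `k`-linear in each of them. -/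
def IsMultilinearOn (k : Type*) {V : Type*} [Semiring k] [AddCommMonoid V]
    [Module k V] (n : ℕ) (A : Op V) : Prop :=
  DependsOn n A ∧
    ∀ i, i < n →
      (∀ (x : ℕ → V) (c : k) (v : V),
        A (Function.update x i (c • v)) = c • A (Function.update x i v)) ∧
      (∀ (x : ℕ → V) (v w : V),
        A (Function.update x i (v + w)) =
          A (Function.update x i v) + A (Function.update x i w))

/-- `A` is alternating in its first `n` arguments. -/
def IsAlternatingOn {V : Type*} [Zero V] (n : ℕ) (A : Op V) : Prop :=
  ∀ x : ℕ → V, ∀ i j, i < n → j < n → i ≠ j → x i = x j → A x = 0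

/-- The number of arguments of an operation of degree `a` (namely `a+1`). -/
def ar (a : ℤ) : ℕ := (a + 1).toNat

/-- Membership in `M^a(V)`: an `(a+1)`-linear map `V^{a+1} → V`
(for `a = -1` this is just a constant, i.e. an element of `V`). -/
def MemM (k : Type*) {V : Type*} [Semiring k] [AddCommMonoid V] [Module k V]
    (a : ℤ) (A : Op V) : Prop := IsMultilinearOn k (ar a) A

/-- Membership in `A^a(V)`: an alternating `(a+1)`-linear map `V^{a+1} → V`. -/
def MemA (k : Type*) {V : Type*} [Semiring k] [AddCommMonoid V] [Module k V]
    (a : ℤ) (A : Op V) : Prop :=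
  IsMultilinearOn k (ar a) A ∧ IsAlternatingOn (ar a) A

/-- The argument sequence `x_0, …, x_{m-1}, B(x_m,…,x_{m+nB-1}), x_{m+nB}, …`
(arguments for the outer operation after inserting the `nB`-ary `B`
at slot `m`). -/
def insertArg {V : Type*} (B : Op V) (nB m : ℕ) (x : ℕ → V) : ℕ → V := fun j =>
  if j < m then x j
  else if j = m then B fun i => x (m + i)
  else x (j + nB - 1)

/-- The Gerstenhaber insertion `ι_B A` of `B ∈ M^b(V)` into `A ∈ M^a(V)`:
`ι_B A(x_0,…,x_{a+b}) = Σ_{m=0}^{a} (−1)^{b·m} A(x_0,…,x_{m−1},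
B(x_m,…,x_{m+b}), x_{m+b+1},…,x_{a+b})`. -/
def gIns {V : Type*} [AddCommGroup V] (a b : ℤ) (A B : Op V) : Op V := fun x =>
  ∑ m ∈ Finset.range (ar a),
    (((-1 : ℤˣ) ^ (b * (m : ℤ)) : ℤˣ) : ℤ) • A (insertArg B (ar b) m x)

/-- The Gerstenhaber bracket `[A,B]^G = −ι_A B + (−1)^{ab} ι_B A` of
`A ∈ M^a(V)` and `B ∈ M^b(V)`. -/
def gBracket {V : Type*} [AddCommGroup V] (a b : ℤ) (A B : Op V) : Op V :=
  -(gIns b a B A) + (((-1 : ℤˣ) ^ (a * b) : ℤˣ) : ℤ) • gIns a b A B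

/-- The set `S(n-1, p-1)` of unshuffle permutations of `{0,…,n-1}` which are
strictly increasing on the first `p` positions and on the remaining ones. -/
def Unshuffles (n p : ℕ) : Finset (Equiv.Perm (Fin n)) :=
  Finset.univ.filter fun σ =>
    (∀ i j : Fin n, (i : ℕ) < (j : ℕ) → (j : ℕ) < p → σ i < σ j) ∧
    (∀ i j : Fin n, (i : ℕ) < (j : ℕ) → p ≤ (i : ℕ) → σ i < σ j)

/-- The Nijenhuis–Richardson insertion `i_B A` of the `nB`-ary `B` into the
`nA`-ary `A`:
`i_B A(x_0,…,x_{a+b}) = Σ_{σ ∈ S(a+b,b)} sgn(σ) ·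
A(B(x_{σ(0)},…,x_{σ(b)}), x_{σ(b+1)},…,x_{σ(a+b)})`
(and `i_B A = 0` when `A` has degree `-1`, i.e. no argument slots). -/
def nrIns {V : Type*} [AddCommGroup V] (nA nB : ℕ) (A B : Op V) : Op V := fun x =>
  if hA : nA = 0 then 0
  else
    ∑ σ ∈ Unshuffles (nA + nB - 1) nB,
      ((Equiv.Perm.sign σ : ℤˣ) : ℤ) •
        A fun j =>
          if hj0 : j = 0 then
            B fun i => if hi : i < nB then x (σ ⟨i, by omega⟩) else 0
          else if hj : j < nA then x (σ ⟨nB + j - 1, by omega⟩) else 0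

/-- The Nijenhuis–Richardson bracket `[A,B]^{NR} = −i_A B + (−1)^{ab} i_B A`
of `A ∈ A^a(V)` and `B ∈ A^b(V)`. -/
def nrBracket {V : Type*} [AddCommGroup V] (a b : ℤ) (A B : Op V) : Op V :=
  -(nrIns (ar b) (ar a) B A) +
    (((-1 : ℤˣ) ^ (a * b) : ℤˣ) : ℤ) • nrIns (ar a) (ar b) A B

/-- The wedge product `A∧B` of the `nA`-ary `A` and the `nB`-ary `B`
(over a commutative algebra `V`):
`(A∧B)(x_0,…,x_{a+b+1}) = Σ_σ sgn(σ) · A(x_{σ(0)},…,x_{σ(a)}) ·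
B(x_{σ(a+1)},…,x_{σ(a+b+1)})` summed over unshuffles. -/
def wedge {V : Type*} [CommRing V] (nA nB : ℕ) (A B : Op V) : Op V := fun x =>
  ∑ σ ∈ Unshuffles (nA + nB) nA,
    ((Equiv.Perm.sign σ : ℤˣ) : ℤ) •
      (A (fun i => if hi : i < nA then x (σ ⟨i, by omega⟩) else 0) *
        B fun j => if hj : j < nB then x (σ ⟨nA + j, by omega⟩) else 0)

/-- The argument sequence `v, x_0, x_1, …`. -/
def consV {V : Type*} (v : V) (x : ℕ → V) : ℕ → V := fun n =>
  if n = 0 then v else x (n - 1)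

/-- The argument sequence `v, w, 0, 0, …` (for applying binary operations). -/
def duo {V : Type*} [Zero V] (v w : V) : ℕ → V := fun n =>
  if n = 0 then v else if n = 1 then w else 0

/-- Membership in `ADer^a(V)`: an alternating `(a+1)`-linear map which (for
`a ≥ 0`) is a derivation in its first (hence, by skew-symmetry, in each)
argument; `ADer^{-1}(V) = V`. -/
def MemADer (k : Type*) {V : Type*} [CommRing k] [CommRing V] [Algebra k V]
    (a : ℤ) (A : Op V) : Prop :=
  IsMultilinearOn k (ar a) A ∧ IsAlternatingOn (ar a) A ∧
    (0 ≤ a → ∀ (f g : V) (x : ℕ → V),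
      A (consV (f * g) x) = f * A (consV g x) + g * A (consV f x))

/-- Membership in `ADiff_1^a(V)`: an alternating `(a+1)`-linear map which (for
`a ≥ 0`) is a first-order differential operator in its first (hence in each)
argument; `ADiff_1^{-1}(V) = V`. -/
def MemADiff1 (k : Type*) {V : Type*} [CommRing k] [CommRing V] [Algebra k V]
    (a : ℤ) (A : Op V) : Prop :=
  IsMultilinearOn k (ar a) A ∧ IsAlternatingOn (ar a) A ∧
    (0 ≤ a → ∀ (f g : V) (x : ℕ → V),
      A (consV (f * g) x) =
        f * A (consV g x) + g * A (consV f x) - f * g * A (consV 1 x))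

/-- `D : V → V` is a differential operator of order `≤ n` on the commutative
algebra `V`. -/
def DiffOrderLe {V : Type*} [CommRing V] : ℕ → (V → V) → Prop
  | 0 => fun D => ∀ f x, D (f * x) = f * D x
  | n + 1 => fun D => ∀ f : V, DiffOrderLe n fun x => D (f * x) - f * D x

/-- Membership in `ADiff^a(V)`: an alternating `(a+1)`-linear map which is a
differential operator of some finite order in each argument separately
(the other arguments being fixed); `ADiff^{-1}(V) = V`. -/
def MemADiff (k : Type*) {V : Type*} [CommRing k] [CommRing V] [Algebra k V]
    (a : ℤ) (A : Op V) : Prop :=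
  IsMultilinearOn k (ar a) A ∧ IsAlternatingOn (ar a) A ∧
    ∀ i, i < ar a → ∃ n, ∀ x : ℕ → V,
      DiffOrderLe n fun v => A (Function.update x i v)

/-- The identity map `I ∈ A^0(V)`. -/
def Iop {V : Type*} : Op V := fun x => x 0

/-- The insertion `i_1 A` of the unit `1 ∈ V = A^{-1}(V)` into `A ∈ A^a(V)`;
for `a ≥ 0` this is `A(1,·,…,·)`. -/
def iUnit {V : Type*} [CommRing V] (a : ℤ) (A : Op V) : Op V :=
  nrIns (ar a) 0 A fun _ => 1

/-- Application of a degree-0 (i.e. unary) operation to an element of `V`. -/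
def app1 {V : Type*} (X : Op V) (v : V) : V := X fun _ => v

/-- The commutator `X∘Y − Y∘X` of two degree-0 operations. -/
def commOp {V : Type*} [AddCommGroup V] (X Y : Op V) : Op V := fun x =>
  app1 X (app1 Y (x 0)) - app1 Y (app1 X (x 0))

/-- The iterated wedge product `X_1 ∧ … ∧ X_m` of a list of degree-0
operations (with the empty product being the unit `1 ∈ V = A^{-1}(V)`). -/
def wedgeList {V : Type*} [CommRing V] : List (Op V) → Op V
  | [] => fun _ => 1
  | X :: l => wedge 1 l.length X (wedgeList l)

open Equiv (Perm)
open Equiv.Perm (sign)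
open scoped Nat

/-- Precomposition of a sequence with a permutation of its first `N` entries, the remaining
entries being replaced by `0`. -/
def permute {V : Type*} [Zero V] {N : ℕ} (σ : Perm (Fin N)) (x : ℕ → V) : ℕ → V :=
  fun i => if h : i < N then x (σ ⟨i, h⟩) else 0

/-- The full antisymmetrization of `F` in its first `N` arguments. -/
def alt {V : Type*} [AddCommGroup V] (N : ℕ) (F : Op V) : Op V := fun x =>
  ∑ σ : Perm (Fin N), ((sign σ : ℤˣ) : ℤ) • F (permute σ x)

/-- `A` depends only on its first `n` arguments and is antisymmetric in them. -/
def IsSkew {V : Type*} [AddCommGroup V] (n : ℕ) (A : Op V) : Prop :=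
  DependsOn n A ∧ ∀ (τ : Perm (Fin n)) (x : ℕ → V),
    A (permute τ x) = ((sign τ : ℤˣ) : ℤ) • A x

/-- The permutation of `Fin N` acting by `τ` on the block `{o, …, o + p - 1}`. -/
def blockPerm {N : ℕ} (o : ℕ) {p : ℕ} (h : o + p ≤ N) (τ : Perm (Fin p)) : Perm (Fin N) :=
  τ.viaFintypeEmbedding
    (⟨fun i => ⟨o + i, by omega⟩, fun i j hij => by
      simp only [Fin.mk.injEq] at hij; ext; omega⟩ : Fin p ↪ Fin N)

section Permute

variable {V : Type*} [AddCommGroup V] {N o p : ℕ}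

lemma sign_blockPerm (h : o + p ≤ N) (τ : Perm (Fin p)) : sign (blockPerm o h τ) = sign τ :=
  Equiv.Perm.viaFintypeEmbedding_sign _ _

lemma blockPerm_apply_add (h : o + p ≤ N) (τ : Perm (Fin p)) (i : ℕ) (hi : i < p)
    (hj : o + i < N) : blockPerm o h τ ⟨o + i, hj⟩ = ⟨o + τ ⟨i, hi⟩, by omega⟩ :=
  Equiv.Perm.viaFintypeEmbedding_apply_image τ _ ⟨i, hi⟩

lemma blockPerm_apply_of_notMem (h : o + p ≤ N) (τ : Perm (Fin p)) (j : Fin N)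
    (hj : (j : ℕ) < o ∨ o + p ≤ j) : blockPerm o h τ j = j := by
  apply Equiv.Perm.viaFintypeEmbedding_apply_notMem_range
  rintro ⟨i, rfl⟩
  have : (i : ℕ) < p := i.2
  change o + (i : ℕ) < o ∨ o + p ≤ o + (i : ℕ) at hj
  omega

lemma permute_apply (σ : Perm (Fin N)) (x : ℕ → V) {i : ℕ} (h : i < N) :
    permute σ x i = x (σ ⟨i, h⟩) := dif_pos h

lemma permute_of_le (σ : Perm (Fin N)) (x : ℕ → V) {i : ℕ} (h : N ≤ i) :
    permute σ x i = 0 := dif_neg (by omega)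

lemma permute_mul (σ τ : Perm (Fin N)) (x : ℕ → V) :
    permute (σ * τ) x = permute τ (permute σ x) := by
  funext i
  by_cases h : i < N <;> simp [permute, h]

lemma permute_blockPerm_add (h : o + p ≤ N) (τ : Perm (Fin p)) (x : ℕ → V) {i : ℕ}
    (hi : i < p) : permute (blockPerm o h τ) x (o + i) = x (o + τ ⟨i, hi⟩) := by
  rw [permute_apply _ _ (by omega : o + i < N), blockPerm_apply_add h τ i hi]

lemma permute_blockPerm_of_notMem_of_lt (h : o + p ≤ N) (τ : Perm (Fin p)) (x : ℕ → V) {j : ℕ}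
    (hj : j < o ∨ o + p ≤ j) (hN : j < N) : permute (blockPerm o h τ) x j = x j := by
  rw [permute_apply _ _ hN, blockPerm_apply_of_notMem h τ _ hj]

lemma permute_blockPerm_of_notMem (h : o + p ≤ N) (τ : Perm (Fin p)) {x : ℕ → V}
    (hx : ∀ j, N ≤ j → x j = 0) {j : ℕ} (hj : j < o ∨ o + p ≤ j) :
    permute (blockPerm o h τ) x j = x j := by
  by_cases hN : j < N
  · exact permute_blockPerm_of_notMem_of_lt h τ x hj hN
  · rw [permute_of_le _ _ (by omega), hx j (by omega)]

lemma alt_congr {F G : Op V} (h : ∀ x : ℕ → V, (∀ j, N ≤ j → x j = 0) → F x = G x) :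
    alt N F = alt N G := by
  funext x
  exact Finset.sum_congr rfl fun σ _ => by rw [h _ fun j hj => permute_of_le σ x hj]

lemma alt_permute_apply (F : Op V) (π : Perm (Fin N)) (x : ℕ → V) :
    alt N F (permute π x) = ((sign π : ℤˣ) : ℤ) • alt N F x := by
  unfold alt
  rw [Finset.smul_sum]
  refine Fintype.sum_equiv (Equiv.mulLeft π) _ _ fun σ => ?_
  simp only [← permute_mul, Equiv.coe_mulLeft, smul_smul, Equiv.Perm.sign_mul, Units.val_mul]
  rw [← mul_assoc, ← Units.val_mul, Int.units_mul_self, Units.val_one, one_mul]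

lemma alt_comp_permute (F : Op V) (π : Perm (Fin N)) :
    alt N (fun x => F (permute π x)) = ((sign π : ℤˣ) : ℤ) • alt N F := by
  funext x
  simp only [alt, Pi.smul_apply, Finset.smul_sum]
  refine Fintype.sum_equiv (Equiv.mulRight π) _ _ fun σ => ?_
  simp only [← permute_mul, Equiv.coe_mulRight, smul_smul, Equiv.Perm.sign_mul, Units.val_mul]
  rw [mul_comm ((sign σ : ℤˣ) : ℤ), ← mul_assoc, ← Units.val_mul, Int.units_mul_self,
    Units.val_one, one_mul]

lemma isSkew_alt (F : Op V) : IsSkew N (alt N F) := by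
  refine ⟨fun x y h => ?_, fun τ x => alt_permute_apply F τ x⟩
  have : ∀ σ : Perm (Fin N), permute σ x = permute σ y := fun σ => by
    funext i
    by_cases hi : i < N
    · rw [permute_apply _ _ hi, permute_apply _ _ hi, h _ (Fin.is_lt _)]
    · rw [permute_of_le _ _ (by omega), permute_of_le _ _ (by omega)]
  simp only [alt, this]

/-- Antisymmetrizing over a block first only multiplies the full antisymmetrization by the
number of permutations of the block. -/
lemma alt_block {F H : Op V} (h : o + p ≤ N)
    (hF : ∀ x : ℕ → V, (∀ j, N ≤ j → x j = 0) →
      F x = ∑ τ : Perm (Fin p), ((sign τ : ℤˣ) : ℤ) • H (permute (blockPerm o h τ) x)) :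
    alt N F = (p ! : ℤ) • alt N H := by
  rw [alt_congr hF]
  have key : ∀ τ : Perm (Fin p), ((sign τ : ℤˣ) : ℤ) •
      alt N (fun x => H (permute (blockPerm o h τ) x)) = alt N H := fun τ => by
    rw [alt_comp_permute, sign_blockPerm, smul_smul, ← Units.val_mul, Int.units_mul_self,
      Units.val_one, one_smul]
  have : alt N (fun x => ∑ τ : Perm (Fin p), ((sign τ : ℤˣ) : ℤ) •
      H (permute (blockPerm o h τ) x)) = ∑ τ : Perm (Fin p), ((sign τ : ℤˣ) : ℤ) •
      alt N (fun x => H (permute (blockPerm o h τ) x)) := by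
    funext x
    simp only [alt, Finset.sum_apply, Pi.smul_apply, Finset.smul_sum]
    rw [Finset.sum_comm]
    exact Finset.sum_congr rfl fun τ _ => Finset.sum_congr rfl fun σ _ => smul_comm _ _ _
  rw [this, Finset.sum_congr rfl fun τ _ => key τ, Finset.sum_const, Finset.card_univ,
    Fintype.card_perm, Fintype.card_fin, natCast_zsmul]

end Permute

section Shuffle

variable {V : Type*} [AddCommGroup V] {N p q : ℕ}

/-- The signed sum of `F` over unshuffles. -/
def shuffleSum (N p : ℕ) (F : Op V) : Op V := fun x =>
  ∑ σ ∈ Unshuffles N p, ((sign σ : ℤˣ) : ℤ) • F (permute σ x)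

/-- The permutation of `Fin (p + q)` acting by `α` on the first `p` and by `β` on the last `q`
elements. -/
def sumPerm (α : Perm (Fin p)) (β : Perm (Fin q)) : Perm (Fin (p + q)) :=
  blockPerm 0 (by omega) α * blockPerm p le_rfl β

lemma sign_sumPerm (α : Perm (Fin p)) (β : Perm (Fin q)) :
    sign (sumPerm α β) = sign α * sign β := by
  rw [sumPerm, Equiv.Perm.sign_mul, sign_blockPerm, sign_blockPerm]

lemma sumPerm_castAdd (α : Perm (Fin p)) (β : Perm (Fin q)) (i : Fin p) :
    sumPerm α β (Fin.castAdd q i) = Fin.castAdd q (α i) := by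
  rw [sumPerm, Equiv.Perm.mul_apply, blockPerm_apply_of_notMem le_rfl β _ (Or.inl i.2)]
  have e : Fin.castAdd q i = ⟨0 + i, by omega⟩ := by ext; simp
  rw [e, blockPerm_apply_add _ α i i.2]
  ext
  simp

lemma sumPerm_natAdd (α : Perm (Fin p)) (β : Perm (Fin q)) (i : Fin q) :
    sumPerm α β (Fin.natAdd p i) = Fin.natAdd p (β i) := by
  rw [sumPerm, Equiv.Perm.mul_apply]
  have := blockPerm_apply_add (N := p + q) (o := p) le_rfl β i i.2 (by omega)
  have h2 : blockPerm p le_rfl β (Fin.natAdd p i) = Fin.natAdd p (β i) := this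
  rw [h2, blockPerm_apply_of_notMem]
  right
  simp

lemma mem_Unshuffles_mul_sumPerm (ρ : Perm (Fin (p + q))) (α : Perm (Fin p))
    (β : Perm (Fin q)) :
    ρ * sumPerm α β ∈ Unshuffles (p + q) p ↔
      Monotone ((fun i => ρ (Fin.castAdd q i)) ∘ α) ∧
        Monotone ((fun i => ρ (Fin.natAdd p i)) ∘ β) := by
  have hp : Function.Injective ((fun i => ρ (Fin.castAdd q i)) ∘ α) := fun i j h => by
    simpa using h
  have hq : Function.Injective ((fun i => ρ (Fin.natAdd p i)) ∘ β) := fun i j h => by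
    simpa using h
  simp only [Unshuffles, Finset.mem_filter, Finset.mem_univ, true_and, Equiv.Perm.mul_apply]
  constructor
  · rintro ⟨h₁, h₂⟩
    refine ⟨StrictMono.monotone fun i j hij => ?_, StrictMono.monotone fun i j hij => ?_⟩
    · have := h₁ (Fin.castAdd q i) (Fin.castAdd q j) hij j.2
      simp only [sumPerm_castAdd] at this
      exact this
    · have := h₂ (Fin.natAdd p i) (Fin.natAdd p j) (by simpa using hij) (by simp)
      simp only [sumPerm_natAdd] at this
      exact this
  · rintro ⟨h₁, h₂⟩
    constructor
    · intro i j hij hj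
      have := h₁.strictMono_of_injective hp
        (show (⟨i, by omega⟩ : Fin p) < ⟨j, hj⟩ from hij)
      simp only [Function.comp_apply, ← sumPerm_castAdd α β] at this
      exact this
    · intro i j hij hi
      have := h₂.strictMono_of_injective hq
        (show (⟨i - p, by omega⟩ : Fin q) < ⟨j - p, by omega⟩ from
          Fin.mk_lt_mk.2 (by omega))
      simp only [Function.comp_apply, ← sumPerm_natAdd α β] at this
      have e : ∀ (l : Fin (p + q)) (hl : p ≤ l),
          Fin.natAdd p (⟨l - p, by omega⟩ : Fin q) = l := fun l hl => by ext; simp; omega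
      rw [e i hi, e j (by omega)] at this
      exact this

lemma alt_eq_smul_shuffleSum {F : Op V}
    (hF : ∀ (α : Perm (Fin p)) (β : Perm (Fin q)) (x : ℕ → V),
      (∀ j, p + q ≤ j → x j = 0) →
      F (permute (sumPerm α β) x) = (((sign α * sign β : ℤˣ)) : ℤ) • F x) :
    alt (p + q) F = ((p ! * q ! : ℕ) : ℤ) • shuffleSum (p + q) p F := by
  funext x
  have h : ∑ t ∈ Unshuffles (p + q) p ×ˢ
      (Finset.univ : Finset (Perm (Fin p) × Perm (Fin q))),
      ((sign t.1 : ℤˣ) : ℤ) • F (permute t.1 x) = alt (p + q) F x := by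
    refine Finset.sum_bij (fun t _ => t.1 * (sumPerm t.2.1 t.2.2)⁻¹)
      (fun _ _ => Finset.mem_univ _) ?_ ?_ ?_
    · rintro ⟨σ, α, β⟩ hs ⟨σ', α', β'⟩ hs' heq
      simp only [Finset.mem_product, Finset.mem_univ, and_true] at hs hs' heq
      set ρ := σ * (sumPerm α β)⁻¹ with hρ
      have e₁ : σ = ρ * sumPerm α β := by rw [hρ, inv_mul_cancel_right]
      have e₂ : σ' = ρ * sumPerm α' β' := by rw [heq, inv_mul_cancel_right]
      rw [e₁, mem_Unshuffles_mul_sumPerm] at hs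
      rw [e₂, mem_Unshuffles_mul_sumPerm] at hs'
      have hα : α = α' := Equiv.ext fun i => by
        simpa using congrFun (Tuple.unique_monotone hs.1 hs'.1) i
      have hβ : β = β' := Equiv.ext fun i => by
        simpa using congrFun (Tuple.unique_monotone hs.2 hs'.2) i
      rw [e₁, e₂, hα, hβ]
    · intro ρ _
      refine ⟨(ρ * sumPerm (Tuple.sort fun i => ρ (Fin.castAdd q i))
        (Tuple.sort fun i => ρ (Fin.natAdd p i)), Tuple.sort fun i => ρ (Fin.castAdd q i),
        Tuple.sort fun i => ρ (Fin.natAdd p i)), ?_, mul_inv_cancel_right _ _⟩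
      simp only [Finset.mem_product, Finset.mem_univ, and_true, mem_Unshuffles_mul_sumPerm]
      exact ⟨Tuple.monotone_sort _, Tuple.monotone_sort _⟩
    · rintro ⟨σ, α, β⟩ _
      have := hF α β (permute (σ * (sumPerm α β)⁻¹) x) fun j hj => permute_of_le _ _ hj
      rw [← permute_mul, inv_mul_cancel_right] at this
      rw [this, smul_smul, Equiv.Perm.sign_mul, Equiv.Perm.sign_inv, sign_sumPerm,
        ← Units.val_mul]
  rw [← h, Finset.sum_product]
  simp only [Finset.sum_const, Finset.card_univ, Fintype.card_prod, Fintype.card_perm,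
    Fintype.card_fin, Pi.smul_apply, shuffleSum, Finset.smul_sum, natCast_zsmul]

end Shuffle

section Products

/-- `A` is odd in each of its first `n` arguments. -/
def IsOddOn {V : Type*} [AddCommGroup V] (n : ℕ) (A : Op V) : Prop :=
  ∀ i, i < n → ∀ (x : ℕ → V) (v : V),
    A (Function.update x i (-v)) = -A (Function.update x i v)

/-- The tensor product `A(x_0,…,x_{p-1}) · B(x_p,…)`. -/
def tmul {V : Type*} [CommRing V] (p : ℕ) (A B : Op V) : Op V := fun x =>
  A x * B fun j => x (p + j)

/-- The composition `A(B(x_0,…,x_{q-1}), x_q, …)`. -/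
def insertFst {V : Type*} (q : ℕ) (A B : Op V) : Op V := fun x =>
  A (consV (B x) fun j => x (q + j))

lemma consV_zero {V : Type*} (v : V) (x : ℕ → V) : consV v x 0 = v := rfl

lemma consV_succ {V : Type*} (v : V) (x : ℕ → V) (i : ℕ) : consV v x (i + 1) = x i := by
  simp [consV]

lemma update_consV_zero {V : Type*} (v w : V) (x : ℕ → V) :
    Function.update (consV v x) 0 w = consV w x := by
  funext i
  cases i <;> simp [Function.update, consV]

lemma dependsOn_insertFst {V : Type*} {n q : ℕ} {A B : Op V} (hA : DependsOn (n + 1) A)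
    (hB : DependsOn q B) : DependsOn (q + n) (insertFst q A B) := by
  intro x y h
  refine hA _ _ fun i hi => ?_
  rcases i with _ | i
  · exact hB _ _ fun i hi => h i (by omega)
  · rw [consV_succ, consV_succ, h _ (by omega)]

section AddCommGroup

variable {V : Type*} [AddCommGroup V] {n p q : ℕ}

lemma permute_sumPerm_of_lt (α : Perm (Fin p)) (β : Perm (Fin q)) (x : ℕ → V) {i : ℕ}
    (hi : i < p) : permute (sumPerm α β) x i = permute α x i := by
  rw [permute_apply _ _ hi, permute_apply _ _ (by omega : i < p + q)]
  exact congrArg (fun l : Fin (p + q) => x l) (sumPerm_castAdd α β ⟨i, hi⟩)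

lemma permute_sumPerm_add (α : Perm (Fin p)) (β : Perm (Fin q)) (x : ℕ → V) {i : ℕ}
    (hi : i < q) :
    permute (sumPerm α β) x (p + i) = permute β (fun j => x (p + j)) i := by
  rw [permute_apply _ _ hi, permute_apply _ _ (by omega : p + i < p + q)]
  exact congrArg (fun l : Fin (p + q) => x l) (sumPerm_natAdd α β ⟨i, hi⟩)

lemma permute_update {N : ℕ} (σ : Perm (Fin N)) (x : ℕ → V) (i : Fin N) (v : V) :
    permute σ (Function.update x (σ i) v) = Function.update (permute σ x) i v := by
  funext j
  by_cases hj : j < N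
  · rw [permute_apply _ _ hj]
    by_cases hij : j = i
    · subst hij
      simp
    · rw [Function.update_of_ne hij, permute_apply _ _ hj, Function.update_of_ne]
      intro h
      apply hij
      have := σ.injective (Fin.ext h)
      rw [← this]
  · rw [permute_of_le _ _ (by omega), Function.update_of_ne (by omega),
      permute_of_le _ _ (by omega)]

lemma isOddOn_alt {N : ℕ} {F : Op V} (hF : IsOddOn N F) : IsOddOn N (alt N F) := by
  intro i hi x v
  simp only [alt, ← Finset.sum_neg_distrib, ← smul_neg]
  refine Finset.sum_congr rfl fun σ _ => ?_
  have e : ∀ w, permute σ (Function.update x i w) =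
      Function.update (permute σ x) (σ.symm ⟨i, hi⟩ : Fin N) w := fun w => by
    rw [← permute_update, Equiv.apply_symm_apply]
  rw [e, e, hF _ (Fin.is_lt _)]

lemma IsSkew.apply_of_eq {A : Op V} (hA : IsSkew n A) (τ : Perm (Fin n)) {x y : ℕ → V}
    (h : ∀ i, i < n → y i = permute τ x i) : A y = ((sign τ : ℤˣ) : ℤ) • A x := by
  rw [hA.1 y _ h, hA.2]

lemma consV_permute_of_lt (β : Perm (Fin n)) (v : V) (x : ℕ → V) {i : ℕ} (hi : i < n + 1) :
    consV v (permute β x) i = permute (blockPerm 1 (by omega) β : Perm (Fin (n + 1)))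
      (consV v x) i := by
  rcases i with _ | i
  · rw [permute_apply _ _ hi, blockPerm_apply_of_notMem _ _ _ (Or.inl Nat.one_pos)]
    rfl
  · rw [consV_succ, Nat.add_comm i 1, permute_blockPerm_add _ _ _ (by omega : i < n),
      permute_apply _ _ (by omega : i < n), Nat.add_comm, consV_succ]

lemma IsOddOn.consV_neg {A : Op V} (hA : IsOddOn (n + 1) A) (v : V) (x : ℕ → V) :
    A (consV (-v) x) = -A (consV v x) := by
  simpa only [update_consV_zero] using hA 0 (by omega) (consV v x) v

lemma IsOddOn.consV_units_smul {A : Op V} (hA : IsOddOn (n + 1) A) (u : ℤˣ) (v : V)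
    (x : ℕ → V) : A (consV ((u : ℤ) • v) x) = (u : ℤ) • A (consV v x) := by
  rcases Int.units_eq_one_or u with rfl | rfl
  · simp
  · simp [hA.consV_neg]

lemma nrIns_eq_shuffleSum {A B : Op V} (hA : DependsOn (n + 1) A) (hB : DependsOn q B) :
    nrIns (n + 1) q A B = shuffleSum (q + n) q (insertFst q A B) := by
  rw [show q + n = n + 1 + q - 1 by omega]
  funext x
  simp only [nrIns, Nat.add_one_ne_zero, dite_false, shuffleSum]
  refine Finset.sum_congr rfl fun σ _ => ?_
  congr 1
  refine hA _ _ fun j hj => ?_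
  rcases j with _ | j
  · rw [dif_pos rfl, consV_zero]
    refine hB _ _ fun i hi => ?_
    rw [dif_pos hi, permute_apply]
  · rw [dif_neg (by omega), dif_pos hj, consV_succ,
      permute_apply _ _ (by omega : q + j < n + 1 + q - 1)]
    rfl

/-- The Nijenhuis–Richardson insertion in terms of the full antisymmetrization. -/
lemma alt_insertFst {A B : Op V} (hA : IsSkew (n + 1) A) (hA' : IsOddOn (n + 1) A)
    (hB : IsSkew q B) :
    alt (q + n) (insertFst q A B) = ((q ! * n ! : ℕ) : ℤ) • nrIns (n + 1) q A B := by
  rw [nrIns_eq_shuffleSum hA.1 hB.1]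
  refine alt_eq_smul_shuffleSum fun α β x _ => ?_
  rw [insertFst, hB.apply_of_eq α fun i hi => permute_sumPerm_of_lt α β x hi,
    hA'.consV_units_smul, Units.val_mul, mul_smul, insertFst,
    hA.1 _ (consV (B x) (permute β fun j => x (q + j))),
    hA.apply_of_eq (blockPerm 1 (by omega) β) fun i hi => consV_permute_of_lt β (B x) _ hi,
    sign_blockPerm]
  intro i hi
  rcases i with _ | i
  · rfl
  · rw [consV_succ, consV_succ, permute_sumPerm_add _ _ _ (by omega)]

end AddCommGroup

section CommRing

variable {V : Type*} [CommRing V] {n p q : ℕ}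

lemma wedge_eq_shuffleSum {A B : Op V} (hA : DependsOn p A) (hB : DependsOn q B) :
    wedge p q A B = shuffleSum (p + q) p (tmul p A B) := by
  funext x
  refine Finset.sum_congr rfl fun σ _ => ?_
  rw [tmul]
  congr 2
  · refine hA _ _ fun i hi => ?_
    rw [dif_pos hi, permute_apply]
  · refine hB _ _ fun i hi => ?_
    rw [dif_pos hi, permute_apply]

/-- The wedge product in terms of the full antisymmetrization. -/
lemma alt_tmul {A B : Op V} (hA : IsSkew p A) (hB : IsSkew q B) :
    alt (p + q) (tmul p A B) = ((p ! * q ! : ℕ) : ℤ) • wedge p q A B := by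
  rw [wedge_eq_shuffleSum hA.1 hB.1]
  refine alt_eq_smul_shuffleSum fun α β x _ => ?_
  rw [tmul, hA.apply_of_eq α fun i hi => permute_sumPerm_of_lt α β x hi,
    hB.apply_of_eq β fun i hi => permute_sumPerm_add α β x hi, smul_mul_smul_comm,
    ← Units.val_mul, tmul]

lemma isOddOn_tmul {A B : Op V} (hA : IsOddOn p A) (hB : IsOddOn q B) (hA' : DependsOn p A) :
    IsOddOn (p + q) (tmul p A B) := by
  intro i hi x v
  rw [tmul, tmul]
  rcases lt_or_ge i p with h | h
  · rw [hA i h, neg_mul]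
    congr 3
    funext j
    rw [Function.update_of_ne (by omega), Function.update_of_ne (by omega)]
  · have e : ∀ w, (fun j => Function.update x i w (p + j)) =
        Function.update (fun j => x (p + j)) (i - p) w := fun w => by
      funext j
      by_cases hj : j = i - p
      · subst hj
        rw [Function.update_self, Nat.add_sub_cancel' h, Function.update_self]
      · rw [Function.update_of_ne hj, Function.update_of_ne (by omega)]
    rw [e, e, hB _ (by omega), mul_neg]
    congr 2
    refine hA' _ _ fun j hj => ?_
    rw [Function.update_of_ne (by omega), Function.update_of_ne (by omega)]

end CommRing

end Products

section BlockSwap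

/-- The permutation of `Fin (p + q)` interchanging the first `p` elements with the last `q`. -/
def blockSwap (p q : ℕ) : Perm (Fin (p + q)) := finRotate (p + q) ^ q

lemma finRotate_pow_apply_val {N : ℕ} (k : ℕ) (i : Fin N) :
    ((finRotate N ^ k) i : ℕ) = (i + k) % N := by
  induction k with
  | zero => simp [Nat.mod_eq_of_lt i.2]
  | succ k ih =>
    have : NeZero N := i.neZero
    rw [pow_succ', Equiv.Perm.mul_apply, finRotate_apply, Fin.val_add, ih, Fin.coe_ofNat_eq_mod,
      ← Nat.add_mod, Nat.add_assoc]

lemma sign_blockSwap (p q : ℕ) : sign (blockSwap p q) = (-1) ^ (p * q) := by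
  rw [blockSwap, map_pow, sign_finRotate, ← pow_mul]
  rcases q with _ | q
  · simp
  · rw [show (p + (q + 1) - 1) * (q + 1) = p * (q + 1) + q * (q + 1) by
      rw [← Nat.add_assoc, Nat.add_sub_cancel, Nat.add_mul], pow_add,
      (Nat.even_mul_succ_self q).neg_one_pow, mul_one]

lemma blockSwap_of_lt {p q i : ℕ} (hi : i < p) (h : i < p + q) :
    (blockSwap p q ⟨i, h⟩ : ℕ) = q + i := by
  rw [blockSwap, finRotate_pow_apply_val, Nat.mod_eq_of_lt (by simp only; omega), Nat.add_comm]

lemma blockSwap_add {p q i : ℕ} (h : p + i < p + q) :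
    (blockSwap p q ⟨p + i, h⟩ : ℕ) = i := by
  rw [blockSwap, finRotate_pow_apply_val, Nat.add_right_comm, Nat.add_mod_left,
    Nat.mod_eq_of_lt (by omega)]

variable {V : Type*} [AddCommGroup V] {N o p q : ℕ}

lemma permute_blockSwap_of_lt (h : o + (p + q) ≤ N) (x : ℕ → V) {i : ℕ} (hi : i < p) :
    permute (blockPerm o h (blockSwap p q)) x (o + i) = x (o + (q + i)) := by
  rw [permute_blockPerm_add _ _ _ (by omega : i < p + q), blockSwap_of_lt hi]

lemma permute_blockSwap_add (h : o + (p + q) ≤ N) (x : ℕ → V) {i : ℕ} (hi : i < q) :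
    permute (blockPerm o h (blockSwap p q)) x (o + (p + i)) = x (o + i) := by
  rw [permute_blockPerm_add _ _ _ (by omega : p + i < p + q), blockSwap_add]

end BlockSwap

section NestedAlternation

variable {V : Type*} [CommRing V] {n p q : ℕ}

lemma alt_tmul_alt_left {G B : Op V} (hG : DependsOn p G) :
    alt (p + q) (tmul p (alt p G) B) = (p ! : ℤ) • alt (p + q) (tmul p G B) := by
  refine alt_block (o := 0) (by omega) fun x hx => ?_
  simp only [tmul, alt, Finset.sum_mul]
  refine Finset.sum_congr rfl fun τ _ => ?_
  rw [smul_mul_assoc]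
  congr 2
  · refine hG _ _ fun i hi => ?_
    have := permute_blockPerm_add (N := p + q) (o := 0) (by omega) τ x hi
    simp only [Nat.zero_add] at this
    rw [this, permute_apply _ _ hi]
  · congr 1
    funext j
    rw [permute_blockPerm_of_notMem _ _ hx (by omega)]

lemma alt_tmul_alt_right {A G : Op V} (hA : DependsOn p A) (hG : DependsOn q G) :
    alt (p + q) (tmul p A (alt q G)) = (q ! : ℤ) • alt (p + q) (tmul p A G) := by
  refine alt_block (o := p) le_rfl fun x hx => ?_
  simp only [tmul, alt, Finset.mul_sum]
  refine Finset.sum_congr rfl fun τ _ => ?_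
  rw [mul_smul_comm]
  congr 2
  · refine hA _ _ fun i hi => ?_
    rw [permute_blockPerm_of_notMem _ _ hx (Or.inl hi)]
  · refine hG _ _ fun i hi => ?_
    rw [permute_blockPerm_add _ _ _ hi, permute_apply _ _ hi]

/-- `A`, regarded as a function of its first argument, as an additive homomorphism. -/
def fstHom (A : Op V) (hA : ∀ (v w : V) (x : ℕ → V),
    A (consV (v + w) x) = A (consV v x) + A (consV w x)) (x : ℕ → V) : V →+ V :=
  AddMonoidHom.mk' (fun v => A (consV v x)) fun v w => hA v w x

lemma alt_insertFst_alt {A G : Op V} (hA : ∀ (v w : V) (x : ℕ → V),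
      A (consV (v + w) x) = A (consV v x) + A (consV w x)) (hG : DependsOn q G) :
    alt (q + n) (insertFst q A (alt q G)) = (q ! : ℤ) • alt (q + n) (insertFst q A G) := by
  refine alt_block (o := 0) (by omega) fun x hx => ?_
  have : insertFst q A (alt q G) x = fstHom A hA (fun j => x (q + j)) (alt q G x) := rfl
  rw [this, alt, map_sum]
  refine Finset.sum_congr rfl fun τ _ => ?_
  rw [map_zsmul]
  congr 1
  change A (consV _ _) = A (consV _ _)
  congr 2
  · refine hG _ _ fun i hi => ?_
    have := permute_blockPerm_add (N := q + n) (o := 0) (by omega) τ x hi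
    simp only [Nat.zero_add] at this
    rw [this, permute_apply _ _ hi]
  · funext j
    rw [permute_blockPerm_of_notMem _ _ hx (by omega)]

lemma alt_zsmul {N : ℕ} (c : ℤ) (F : Op V) : alt N (c • F) = c • alt N F := by
  funext x
  simp only [alt, Pi.smul_apply, Finset.smul_sum]
  exact Finset.sum_congr rfl fun σ _ => smul_comm _ _ _

lemma alt_add {N : ℕ} (F G : Op V) : alt N (F + G) = alt N F + alt N G := by
  funext x
  simp only [alt, Pi.add_apply, smul_add, Finset.sum_add_distrib]

lemma alt_neg {N : ℕ} (F : Op V) : alt N (-F) = -alt N F := by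
  simpa using alt_zsmul (N := N) (-1) F

lemma alt_sum {N : ℕ} {ι : Type*} (s : Finset ι) (F : ι → Op V) :
    alt N (∑ i ∈ s, F i) = ∑ i ∈ s, alt N (F i) := by
  funext x
  simp only [alt, Finset.sum_apply, Finset.smul_sum]
  exact Finset.sum_comm

lemma tmul_zsmul_left (c : ℤ) (A B : Op V) : tmul p (c • A) B = c • tmul p A B := by
  funext x
  simp only [tmul, Pi.smul_apply, smul_mul_assoc]

lemma tmul_zsmul_right (c : ℤ) (A B : Op V) : tmul p A (c • B) = c • tmul p A B := by
  funext x
  simp only [tmul, Pi.smul_apply, mul_smul_comm]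

lemma tmul_assoc (A B C : Op V) : tmul (p + q) (tmul p A B) C = tmul p A (tmul q B C) := by
  funext x
  simp only [tmul, mul_assoc, Nat.add_assoc]

lemma alt_tmul_comm {A B : Op V} (hA : DependsOn p A) (hB : DependsOn q B) :
    alt (p + q) (tmul q B A) = ((-1) ^ (p * q) : ℤ) • alt (p + q) (tmul p A B) := by
  have h : 0 + (q + p) ≤ p + q := by omega
  have := alt_comp_permute (tmul q B A) (blockPerm 0 h (blockSwap q p))
  rw [sign_blockPerm, sign_blockSwap] at this
  have e : alt (p + q) (fun x => tmul q B A (permute (blockPerm 0 h (blockSwap q p)) x)) =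
      alt (p + q) (tmul p A B) := by
    congr 1
    funext x
    rw [tmul, tmul, mul_comm]
    congr 1
    · refine hA _ _ fun i hi => ?_
      simpa using permute_blockSwap_add h x hi
    · refine hB _ _ fun i hi => ?_
      simpa using permute_blockSwap_of_lt h x hi
  rw [e] at this
  rw [this, smul_smul]
  push_cast
  rw [Nat.mul_comm q p, ← mul_pow, neg_mul_neg, one_mul, one_pow, one_smul]

lemma isSkew_Iop : IsSkew 1 (Iop : Op V) := by
  refine ⟨fun x y h => h 0 Nat.one_pos, fun τ x => ?_⟩
  rw [Subsingleton.elim τ 1]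
  simp [Iop, permute]

lemma isOddOn_Iop : IsOddOn 1 (Iop : Op V) := by
  intro i hi x v
  obtain rfl : i = 0 := by omega
  simp [Iop]

lemma wedge_zero_right (A : Op V) : wedge p q A 0 = 0 := by
  funext x
  simp [wedge]

lemma wedge_zero_left (B : Op V) : wedge p q 0 B = 0 := by
  funext x
  simp [wedge]

end NestedAlternation

section TorsionFree

variable {V : Type*} [CommRing V] [IsAddTorsionFree V] {n p q r : ℕ}

lemma factorial_mul_factorial_ne_zero (p q : ℕ) : ((p ! * q ! : ℕ) : ℤ) ≠ 0 := by positivity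

lemma op_smul_cancel {c : ℤ} (hc : c ≠ 0) {F G : Op V} (h : c • F = c • G) : F = G :=
  zsmul_right_injective hc h

lemma IsSkew.of_smul {A : Op V} {c : ℤ} (hc : c ≠ 0) (hA : IsSkew n (c • A)) : IsSkew n A :=
  ⟨fun x y h => zsmul_right_injective hc (hA.1 x y h), fun τ x => zsmul_right_injective hc
    ((hA.2 τ x).trans (smul_comm _ c (A x)))⟩

lemma IsOddOn.of_smul {A : Op V} {c : ℤ} (hc : c ≠ 0) (hA : IsOddOn n (c • A)) : IsOddOn n A :=
  fun i hi x v => zsmul_right_injective hc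
    ((hA i hi x v).trans (smul_neg c (A (Function.update x i v))).symm)

lemma isSkew_wedge {A B : Op V} (hA : IsSkew p A) (hB : IsSkew q B) :
    IsSkew (p + q) (wedge p q A B) :=
  .of_smul (factorial_mul_factorial_ne_zero p q) (alt_tmul hA hB ▸ isSkew_alt _)

lemma isOddOn_wedge {A B : Op V} (hA : IsSkew p A) (hB : IsSkew q B) (hA' : IsOddOn p A)
    (hB' : IsOddOn q B) : IsOddOn (p + q) (wedge p q A B) :=
  .of_smul (factorial_mul_factorial_ne_zero p q)
    (alt_tmul hA hB ▸ isOddOn_alt (isOddOn_tmul hA' hB' hA.1))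

lemma isSkew_nrIns {A B : Op V} (hA : IsSkew (n + 1) A) (hA' : IsOddOn (n + 1) A)
    (hB : IsSkew q B) : IsSkew (q + n) (nrIns (n + 1) q A B) :=
  .of_smul (factorial_mul_factorial_ne_zero q n) (alt_insertFst hA hA' hB ▸ isSkew_alt _)

lemma wedge_assoc {A B C : Op V} (hA : IsSkew p A) (hB : IsSkew q B) (hC : IsSkew r C) :
    wedge (p + q) r (wedge p q A B) C = wedge p (q + r) A (wedge q r B C) := by
  have hAB : DependsOn (p + q) (tmul p A B) := fun x y h => by
    rw [tmul, tmul, hA.1 x y fun i hi => h i (by omega),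
      hB.1 _ (fun j => y (p + j)) fun i hi => h _ (by omega)]
  have hBC : DependsOn (q + r) (tmul q B C) := fun x y h => by
    rw [tmul, tmul, hB.1 x y fun i hi => h i (by omega),
      hC.1 _ (fun j => y (q + j)) fun i hi => h _ (by omega)]
  have h₁ := alt_tmul_alt_left (q := r) (B := C) hAB
  have h₂ := alt_tmul_alt_right hA.1 hBC
  rw [alt_tmul hA hB, tmul_zsmul_left, alt_zsmul, alt_tmul (isSkew_wedge hA hB) hC,
    tmul_assoc] at h₁
  rw [alt_tmul hB hC, tmul_zsmul_right, alt_zsmul, alt_tmul hA (isSkew_wedge hB hC),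
    ← Nat.add_assoc] at h₂
  refine op_smul_cancel (c := (p ! * q ! * (p + q) ! * r ! * (q + r) ! : ℕ)) (by positivity) ?_
  have h₁' := congrArg (fun F : Op V => ((q + r) ! : ℤ) • F) h₁
  have h₂' := congrArg (fun F : Op V => ((p + q) ! : ℤ) • F) h₂
  simp only [smul_smul] at h₁' h₂'
  rw [mul_comm ((p + q) ! : ℤ) ((q + r) ! : ℤ), ← h₁'] at h₂'
  push_cast at h₂' ⊢
  convert h₂'.symm using 2 <;> ring

lemma wedge_comm {A B : Op V} (hA : IsSkew p A) (hB : IsSkew q B) :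
    wedge q p B A = ((-1) ^ (p * q) : ℤ) • wedge p q A B := by
  refine op_smul_cancel (factorial_mul_factorial_ne_zero q p) ?_
  rw [← alt_tmul hB hA, smul_comm, Nat.mul_comm (q !), ← alt_tmul hA hB, Nat.add_comm q p,
    alt_tmul_comm hA.1 hB.1]

lemma wedge_Iop_wedge_Iop {C : Op V} (hC : IsSkew n C) :
    wedge 1 (1 + n) Iop (wedge 1 n Iop C) = 0 := by
  rw [← wedge_assoc isSkew_Iop isSkew_Iop hC]
  have := wedge_comm (isSkew_Iop (V := V)) isSkew_Iop
  rw [mul_one, pow_one, neg_one_smul] at this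
  have h₀ : wedge 1 1 (Iop : Op V) Iop = 0 := by
    refine op_smul_cancel two_ne_zero ?_
    rw [two_smul, smul_zero]
    nth_rewrite 1 [this]
    exact neg_add_cancel _
  rw [h₀, wedge_zero_left]

end TorsionFree

section Insertion

variable {V : Type*} [CommRing V] [IsAddTorsionFree V] {n m b : ℕ}

lemma wedge_Iop_apply {C : Op V} (hC : IsSkew n C) (y : ℕ → V) :
    wedge 1 n Iop C y = tmul 1 Iop C y -
      ∑ i : Fin n, y (1 + i) * C (Function.update (fun j => y (1 + j)) i (y 0)) := by
  have hn : ((n ! : ℕ) : ℤ) ≠ 0 := by positivity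
  have hw := congrFun (alt_tmul isSkew_Iop hC) y
  rw [Nat.factorial_one, one_mul, Pi.smul_apply, Nat.add_comm 1 n] at hw
  refine zsmul_right_injective hn ?_
  simp only
  rw [← hw, alt, ← Equiv.sum_comp Equiv.Perm.decomposeFin.symm, Fintype.sum_prod_type]
  have key : ∀ (p : Fin (n + 1)) (e : Perm (Fin n)) (z : ℕ → V),
      (∀ (i : ℕ) (hi : i < n), z i = y (Equiv.swap 0 p (Fin.succ ⟨i, hi⟩))) →
      ((sign (Equiv.Perm.decomposeFin.symm (p, e)) : ℤˣ) : ℤ) •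
        tmul 1 Iop C (permute (Equiv.Perm.decomposeFin.symm (p, e)) y) =
      (((if p = 0 then 1 else -1 : ℤˣ)) : ℤ) • (y p * C z) := by
    intro p e z hz
    have h₁ : Iop (permute (Equiv.Perm.decomposeFin.symm (p, e)) y) = y p := by
      rw [Iop, permute_apply _ _ (Nat.succ_pos n)]
      exact congrArg (fun l : Fin (n + 1) => y l)
        (Equiv.Perm.decomposeFin_symm_apply_zero p e)
    have h₂ : C (fun j => permute (Equiv.Perm.decomposeFin.symm (p, e)) y (1 + j)) =
        ((sign e : ℤˣ) : ℤ) • C z := by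
      refine hC.apply_of_eq e fun i hi => ?_
      rw [permute_apply _ _ hi, hz _ (Fin.is_lt _), permute_apply _ _ (by omega : 1 + i < n + 1)]
      have := Equiv.Perm.decomposeFin_symm_apply_succ e p ⟨i, hi⟩
      rw [Fin.eta, ← this]
      congr 3
      ext
      simp [Nat.add_comm]
    rw [tmul, h₁, h₂, mul_smul_comm, smul_smul, Equiv.Perm.decomposeFin.symm_sign,
      ← Units.val_mul, mul_assoc, Int.units_mul_self, mul_one]
  rw [Fin.sum_univ_succ, smul_sub, sub_eq_add_neg, Finset.smul_sum, ← Finset.sum_neg_distrib]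
  have hcard : ∀ v : V, ∑ _e : Perm (Fin n), v = (n ! : ℤ) • v := fun v => by
    rw [Finset.sum_const, Finset.card_univ, Fintype.card_perm, Fintype.card_fin, natCast_zsmul]
  congr 1
  · rw [Finset.sum_congr rfl fun e _ => key 0 e (fun j => y (1 + j)) fun i hi => ?_, hcard]
    · simp [tmul, Iop]
    · simp [Nat.add_comm]
  · refine Finset.sum_congr rfl fun i _ => ?_
    rw [Finset.sum_congr rfl fun e _ => key i.succ e
      (Function.update (fun j => y (1 + j)) i (y 0)) fun j hj => ?_, hcard]
    · simp [Nat.add_comm]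
    · by_cases hij : j = i
      · subst hij
        simp
      · rw [Function.update_of_ne hij, Equiv.swap_apply_of_ne_of_ne (Fin.succ_ne_zero _)]
        · simp [Nat.add_comm]
        · intro h
          exact hij (congrArg Fin.val (Fin.succ_injective _ h))

lemma alt_Iop_insertFst {q : ℕ} {A B : Op V} (hA : IsSkew (n + 1) A) (hA' : IsOddOn (n + 1) A)
    (hB : IsSkew q B) :
    alt (1 + (q + n)) (tmul 1 Iop (insertFst q A B)) =
      ((q ! * n ! : ℕ) : ℤ) • wedge 1 (q + n) Iop (nrIns (n + 1) q A B) := by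
  refine op_smul_cancel (c := (q + n)!) (by positivity) ?_
  rw [← alt_tmul_alt_right isSkew_Iop.1 (dependsOn_insertFst hA.1 hB.1),
    alt_insertFst hA hA' hB, tmul_zsmul_right, alt_zsmul,
    alt_tmul isSkew_Iop (isSkew_nrIns hA hA' hB), Nat.factorial_one, one_mul, smul_comm]

/-- Insertion into `I ∧ C` obeys a graded Leibniz rule. -/
lemma nrIns_wedge_Iop {C B : Op V} (hC : IsSkew n C) (hC' : IsOddOn n C)
    (hB : IsSkew (b + 1) B) :
    nrIns (n + 1) (b + 1) (wedge 1 n Iop C) B =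
      wedge (b + 1) n B C +
        ((-1) ^ b : ℤ) • wedge 1 (b + n) Iop (nrIns n (b + 1) C B) := by
  have hW : IsSkew (n + 1) (wedge 1 n Iop C) := Nat.add_comm 1 n ▸ isSkew_wedge isSkew_Iop hC
  have hW' : IsOddOn (n + 1) (wedge 1 n Iop C) :=
    Nat.add_comm 1 n ▸ isOddOn_wedge isSkew_Iop hC isOddOn_Iop hC'
  refine op_smul_cancel (factorial_mul_factorial_ne_zero (b + 1) n) ?_
  rw [← alt_insertFst hW hW' hB, smul_add, ← alt_tmul hB hC]
  let G : Fin n → Op V := fun i x =>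
    x (b + 1 + i) * C (Function.update (fun j => x (b + 1 + j)) i (B x))
  have e : insertFst (b + 1) (wedge 1 n Iop C) B = tmul (b + 1) B C + -∑ i, G i := by
    funext x
    rw [insertFst, wedge_Iop_apply hC, Pi.add_apply, Pi.neg_apply, Finset.sum_apply,
      sub_eq_add_neg]
    have h : ∀ j, consV (B x) (fun j => x (b + 1 + j)) (1 + j) = x (b + 1 + j) := fun j => by
      rw [Nat.add_comm 1 j, consV_succ]
    simp only [tmul, Iop, consV_zero, h, G]
  rw [e, alt_add, alt_neg, alt_sum]
  congr 1
  rcases n with _ | n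
  · have : nrIns 0 (b + 1) C B = 0 := by
      funext x
      simp [nrIns]
    simp [this, wedge_zero_right]
  have hG : ∀ i, alt (b + 1 + (n + 1)) (G i) = alt (b + 1 + (n + 1)) (G 0) := by
    intro i
    have h : b + 1 + (n + 1) ≤ b + 1 + (n + 1) := le_rfl
    have := alt_comp_permute (G 0) (blockPerm (b + 1) h (Equiv.swap 0 i))
    rw [sign_blockPerm] at this
    have e : (fun x => G 0 (permute (blockPerm (b + 1) h (Equiv.swap 0 i)) x)) =
        ((sign (Equiv.swap 0 i) : ℤˣ) : ℤ) • G i := by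
      funext x
      have hx : ∀ j (hj : j < n + 1), permute (blockPerm (b + 1) h (Equiv.swap 0 i)) x
          (b + 1 + j) = x (b + 1 + Equiv.swap 0 i ⟨j, hj⟩) :=
        fun j hj => permute_blockPerm_add h _ x hj
      have hBx : B (permute (blockPerm (b + 1) h (Equiv.swap 0 i)) x) = B x :=
        hB.1 _ _ fun j hj => permute_blockPerm_of_notMem_of_lt h _ x (Or.inl hj) (by omega)
      simp only [G, Pi.smul_apply]
      rw [hBx, Fin.val_zero, hx 0 n.succ_pos, ← mul_smul_comm]
      congr 1
      refine hC.apply_of_eq _ fun j hj => ?_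
      rw [permute_apply _ _ hj]
      rcases j with _ | j
      · simp
      · rw [Function.update_of_ne (by omega), hx _ hj, Function.update_of_ne]
        rw [Ne, Fin.val_inj, Equiv.swap_apply_eq_iff, Equiv.swap_apply_right]
        simp [Fin.ext_iff]
    rw [e, alt_zsmul] at this
    refine op_smul_cancel ?_ this
    exact Units.ne_zero _
  rw [Finset.sum_congr rfl fun i _ => hG i, Finset.sum_const, Finset.card_univ, Fintype.card_fin]
  have h : 0 + (1 + (b + 1)) ≤ b + 1 + (n + 1) := by omega
  have key := alt_comp_permute (tmul 1 Iop (insertFst (b + 1) C B))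
    (blockPerm 0 h (blockSwap 1 (b + 1)))
  rw [sign_blockPerm, sign_blockSwap] at key
  have e₀ : alt (b + 1 + (n + 1)) (fun x => tmul 1 Iop (insertFst (b + 1) C B)
      (permute (blockPerm 0 h (blockSwap 1 (b + 1))) x)) = alt (b + 1 + (n + 1)) (G 0) := by
    congr 1
    funext x
    have h₀ := permute_blockSwap_of_lt h x Nat.one_pos
    have h₁ := fun i => permute_blockSwap_add h x (i := i)
    simp only [Nat.zero_add, Nat.add_zero] at h₀ h₁
    simp only [G, tmul, Iop, insertFst, h₀, Fin.val_zero, Nat.add_zero]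
    congr 1
    refine hC.1 _ _ fun i hi => ?_
    rcases i with _ | i
    · rw [consV_zero, Function.update_self]
      exact hB.1 _ _ fun i hi => h₁ i hi
    · rw [consV_succ, Function.update_of_ne (by omega),
        permute_blockPerm_of_notMem_of_lt _ _ _ (by omega) (by omega)]
      congr 1
      omega
  rw [e₀, show b + 1 + (n + 1) = 1 + (b + 1 + n) by omega, alt_Iop_insertFst hC hC' hB] at key
  rw [show b + 1 + (n + 1) = 1 + (b + 1 + n) by omega, key,
    show b + (n + 1) = b + 1 + n by omega, ← natCast_zsmul, ← smul_neg, smul_smul, smul_smul,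
    smul_neg, ← neg_smul, Nat.factorial_succ n, smul_smul]
  congr 1
  push_cast
  ring

/-- Insertion of `I ∧ C` into a multiderivation. -/
lemma nrIns_of_wedge_Iop {A C : Op V} (hA : IsSkew (n + 1) A) (hA' : IsOddOn (n + 1) A)
    (hadd : ∀ (v w : V) (x : ℕ → V), A (consV (v + w) x) = A (consV v x) + A (consV w x))
    (hder : ∀ (f g : V) (x : ℕ → V),
      A (consV (f * g) x) = f * A (consV g x) + g * A (consV f x)) (hC : IsSkew m C) :
    nrIns (n + 1) (m + 1) A (wedge 1 m Iop C) =
      wedge 1 (n + m) Iop (nrIns (n + 1) m A C) +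
        ((n + 1) * (-1) ^ (n * m) : ℤ) • wedge (n + 1) m A C := by
  have hW : IsSkew (m + 1) (wedge 1 m Iop C) := Nat.add_comm 1 m ▸ isSkew_wedge isSkew_Iop hC
  have hI : DependsOn (m + 1) (tmul 1 (Iop : Op V) C) := by
    intro x y h
    rw [tmul, tmul, isSkew_Iop.1 x y fun i hi => h i (by omega),
      hC.1 _ (fun j => y (1 + j)) fun i hi => h _ (by omega)]
  have hw := alt_tmul isSkew_Iop hC
  rw [Nat.factorial_one, one_mul, Nat.add_comm 1 m] at hw
  have hins : insertFst (m + 1) A ((m ! : ℤ) • wedge 1 m Iop C) =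
      (m ! : ℤ) • insertFst (m + 1) A (wedge 1 m Iop C) := by
    funext x
    exact map_zsmul (fstHom A hadd fun j => x (m + 1 + j)) (m ! : ℤ) _
  have h₁ := alt_insertFst_alt (n := n) hadd hI
  rw [hw, hins, alt_zsmul, alt_insertFst hA hA' hW] at h₁
  let E : Op V := fun x => C (fun j => x (1 + j)) * A (consV (x 0) fun j => x (m + 1 + j))
  have h₂ : insertFst (m + 1) A (tmul 1 Iop C) = tmul 1 Iop (insertFst m A C) + E := by
    funext x
    simp only [insertFst, tmul, Iop, hder, Pi.add_apply, E]
    simp only [Nat.add_comm m 1, Nat.add_assoc]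
  have h : 1 + (n + m) ≤ m + 1 + n := by omega
  have h₃ := alt_comp_permute (tmul (n + 1) A C) (blockPerm 1 h (blockSwap n m))
  rw [sign_blockPerm, sign_blockSwap] at h₃
  have h₄ : alt (m + 1 + n) (fun x => tmul (n + 1) A C
      (permute (blockPerm 1 h (blockSwap n m)) x)) = alt (m + 1 + n) E := by
    congr 1
    funext x
    simp only [tmul, E]
    rw [mul_comm]
    congr 1
    · refine hC.1 _ _ fun i hi => ?_
      rw [← permute_blockSwap_add h x hi]
      congr 1
      omega
    · refine hA.1 _ _ fun i hi => ?_
      rcases i with _ | i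
      · rw [permute_blockPerm_of_notMem_of_lt _ _ _ (by omega) (by omega), consV_zero]
      · rw [consV_succ, Nat.add_comm i 1, permute_blockSwap_of_lt h x (by omega : i < n)]
        congr 1
        omega
  rw [h₂, alt_add, ← h₄, h₃, show m + 1 + n = n + 1 + m by omega, alt_tmul hA hC,
    show n + 1 + m = 1 + (m + n) by omega, alt_Iop_insertFst hA hA' hC] at h₁
  refine op_smul_cancel (c := (m ! * ((m + 1)! * n !) : ℕ)) (by positivity) ?_
  rw [Nat.cast_mul, mul_smul, h₁, smul_add, smul_add, smul_smul, smul_smul, smul_smul, smul_smul,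
    Nat.add_comm n m, Nat.factorial_succ n]
  congr 2 <;> push_cast <;> ring

end Insertion

section Multiderivations

variable {k V : Type*} [Field k] [CommRing V] [Algebra k V]

lemma IsMultilinearOn.isOddOn {n : ℕ} {A : Op V} (hA : IsMultilinearOn k n A) :
    IsOddOn n A := fun i hi x v => by
  simpa only [neg_smul, one_smul] using (hA.2 i hi).1 x (-1) v

lemma IsMultilinearOn.consV_add {n : ℕ} {A : Op V} (hA : IsMultilinearOn k (n + 1) A)
    (v w : V) (x : ℕ → V) : A (consV (v + w) x) = A (consV v x) + A (consV w x) := by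
  simpa only [update_consV_zero] using (hA.2 0 n.succ_pos).2 (consV 0 x) v w

/-- An alternating multilinear operation as an alternating map on tuples. -/
def toAlternatingMap {n : ℕ} {A : Op V} (hA : IsMultilinearOn k n A)
    (hA' : IsAlternatingOn n A) : V [⋀^Fin n]→ₗ[k] V :=
  have e (m : Fin n → V) (i : Fin n) (v : V) [DecidableEq (Fin n)] :
      (fun j => if h : j < n then Function.update m i v ⟨j, h⟩ else 0) =
        Function.update (fun j => if h : j < n then m ⟨j, h⟩ else 0) (i : ℕ) v := by
    funext j
    by_cases hj : j = i
    · subst hj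
      simp
    · by_cases h : j < n <;> simp [h, hj, Function.update, Fin.ext_iff]
  { toFun := fun m => A fun j => if h : j < n then m ⟨j, h⟩ else 0
    map_update_add' := fun m i v w => by
      simp only [e]
      exact (hA.2 i i.2).2 _ v w
    map_update_smul' := fun m i c v => by
      simp only [e]
      exact (hA.2 i i.2).1 _ c v
    map_eq_zero_of_eq' := fun m i j hij hne =>
      hA' _ i j i.2 j.2 (fun h => hne (Fin.ext h)) (by simpa using hij) }

lemma IsMultilinearOn.isSkew {n : ℕ} {A : Op V} (hA : IsMultilinearOn k n A)
    (hA' : IsAlternatingOn n A) : IsSkew n A := by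
  refine ⟨hA.1, fun τ x => ?_⟩
  have h := (toAlternatingMap hA hA').map_perm (fun i => x i) τ
  have e : (toAlternatingMap hA hA') (fun i => x i) = A x :=
    hA.1 _ _ fun i hi => dif_pos hi
  rw [e, Units.smul_def] at h
  exact h

end Multiderivations

section Bracket

variable {V : Type*} [CommRing V] {n p q : ℕ}

lemma nrIns_add_left (A A' B : Op V) : nrIns n q (A + A') B = nrIns n q A B + nrIns n q A' B := by
  funext x
  rcases n with _ | n
  · simp [nrIns]
  · simp [nrIns, Finset.sum_add_distrib]

lemma nrIns_add_right {A B B' : Op V} (hA : DependsOn (n + 1) A)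
    (hadd : ∀ (v w : V) (x : ℕ → V), A (consV (v + w) x) = A (consV v x) + A (consV w x))
    (hB : DependsOn q B) (hB' : DependsOn q B') :
    nrIns (n + 1) q A (B + B') = nrIns (n + 1) q A B + nrIns (n + 1) q A B' := by
  have h : DependsOn q (B + B') := fun x y hxy => by
    rw [Pi.add_apply, Pi.add_apply, hB x y hxy, hB' x y hxy]
  rw [nrIns_eq_shuffleSum hA hB, nrIns_eq_shuffleSum hA hB', nrIns_eq_shuffleSum hA h]
  funext x
  simp only [shuffleSum, insertFst, Pi.add_apply, hadd, smul_add, Finset.sum_add_distrib]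

lemma wedge_add_left (A A' B : Op V) : wedge p q (A + A') B = wedge p q A B + wedge p q A' B := by
  funext x
  simp [wedge, add_mul, Finset.sum_add_distrib]

lemma wedge_add_right (A B B' : Op V) :
    wedge p q A (B + B') = wedge p q A B + wedge p q A B' := by
  funext x
  simp [wedge, mul_add, Finset.sum_add_distrib]

lemma wedge_zsmul_right (c : ℤ) (A B : Op V) : wedge p q A (c • B) = c • wedge p q A B := by
  funext x
  simp only [wedge, Pi.smul_apply, mul_smul_comm, Finset.smul_sum, smul_comm c]

lemma wedge_neg_right (A B : Op V) : wedge p q A (-B) = -wedge p q A B := by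
  simpa using wedge_zsmul_right (p := p) (q := q) (-1) A B

/-- The insertion of `B₁ + I ∧ B₂` into `A₁ + I ∧ A₂` for multiderivations. -/
lemma nrIns_splitting [IsAddTorsionFree V] {n m : ℕ} {A₁ A₂ B₁ B₂ : Op V}
    (hA₁ : IsSkew (n + 1) A₁) (hA₁' : IsOddOn (n + 1) A₁)
    (hA₁add : ∀ (v w : V) (x : ℕ → V), A₁ (consV (v + w) x) = A₁ (consV v x) + A₁ (consV w x))
    (hA₁der : ∀ (f g : V) (x : ℕ → V),
      A₁ (consV (f * g) x) = f * A₁ (consV g x) + g * A₁ (consV f x))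
    (hA₂ : IsSkew n A₂) (hA₂' : IsOddOn n A₂)
    (hA₂add : 0 < n → ∀ (v w : V) (x : ℕ → V),
      A₂ (consV (v + w) x) = A₂ (consV v x) + A₂ (consV w x))
    (hA₂der : 0 < n → ∀ (f g : V) (x : ℕ → V),
      A₂ (consV (f * g) x) = f * A₂ (consV g x) + g * A₂ (consV f x))
    (hB₁ : IsSkew (m + 1) B₁) (hB₂ : IsSkew m B₂) :
    nrIns (n + 1) (m + 1) (A₁ + wedge 1 n Iop A₂) (B₁ + wedge 1 m Iop B₂) =
      nrIns (n + 1) (m + 1) A₁ B₁ + wedge 1 (n + m) Iop (nrIns (n + 1) m A₁ B₂) +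
        ((n + 1) * (-1) ^ (n * m) : ℤ) • wedge (n + 1) m A₁ B₂ +
        ((-1) ^ (n * (m + 1)) : ℤ) • wedge n (m + 1) A₂ B₁ +
        ((-1) ^ m : ℤ) • wedge 1 (n + m) Iop (nrIns n (m + 1) A₂ B₁) +
        ((n + 1) * (-1) ^ (n * m) : ℤ) • wedge 1 (n + m) Iop (wedge n m A₂ B₂) := by
  have hW : IsSkew (m + 1) (wedge 1 m Iop B₂) := Nat.add_comm 1 m ▸ isSkew_wedge isSkew_Iop hB₂
  have hB : IsSkew (m + 1) (B₁ + wedge 1 m Iop B₂) :=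
    ⟨fun x y h => by rw [Pi.add_apply, Pi.add_apply, hB₁.1 x y h, hW.1 x y h],
      fun τ x => by rw [Pi.add_apply, Pi.add_apply, hB₁.2, hW.2, smul_add]⟩
  have hI : wedge (m + 1) n (wedge 1 m Iop B₂) A₂ =
      ((-1) ^ (n * m) : ℤ) • wedge 1 (n + m) Iop (wedge n m A₂ B₂) := by
    rw [Nat.add_comm m 1, wedge_assoc isSkew_Iop hB₂ hA₂, wedge_comm hA₂ hB₂,
      wedge_zsmul_right, Nat.add_comm m n]
  have hA₂B : wedge 1 (m + n) Iop (nrIns n (m + 1) A₂ (B₁ + wedge 1 m Iop B₂)) =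
      wedge 1 (n + m) Iop (nrIns n (m + 1) A₂ B₁) +
        (n * ((-1) ^ m * (-1) ^ (n * m)) : ℤ) • wedge 1 (n + m) Iop (wedge n m A₂ B₂) := by
    rcases n with _ | n
    · have h₀ : ∀ F : Op V, nrIns 0 (m + 1) A₂ F = 0 := fun F => by
        funext x
        simp [nrIns]
      simp [h₀, wedge_zero_right]
    · rw [nrIns_add_right hA₂.1 (hA₂add n.succ_pos) hB₁.1 hW.1,
        nrIns_of_wedge_Iop hA₂ hA₂' (hA₂add n.succ_pos) (hA₂der n.succ_pos) hB₂,
        wedge_add_right, wedge_add_right, wedge_zsmul_right,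
        show m + (n + 1) = 1 + (n + m) by omega,
        wedge_Iop_wedge_Iop (Nat.add_comm m n ▸ isSkew_nrIns hA₂ hA₂' hB₂), zero_add,
        show 1 + (n + m) = n + 1 + m by omega]
      congr 2
      push_cast
      rw [← pow_add, show m + (n + 1) * m = n * m + 2 * m by ring, pow_add, pow_mul]
      simp
  rw [nrIns_add_left, nrIns_add_right hA₁.1 hA₁add hB₁.1 hW.1,
    nrIns_of_wedge_Iop hA₁ hA₁' hA₁add hA₁der hB₂, nrIns_wedge_Iop hA₂ hA₂' hB,
    wedge_add_left, hI, hA₂B, wedge_comm hA₂ hB₁, smul_add, smul_smul]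
  have hm : ((-1) ^ m : ℤ) * (n * ((-1) ^ m * (-1) ^ (n * m))) = n * (-1) ^ (n * m) := by
    rw [mul_left_comm, ← mul_assoc ((-1 : ℤ) ^ m), ← mul_pow, neg_mul_neg, one_mul, one_pow,
      one_mul]
  rw [hm]
  module

end Bracket

/-- in terms of the splitting of first-order multidifferential
operators, the Nijenhuis–Richardson bracket is given by formula (dif):
`[A_1 + I∧A_2, B_1 + I∧B_2] = [A_1,B_1] + (−1)^a I∧[A_1,B_2] + I∧[A_2,B_1]
+ a·A_1∧B_2 − (−1)^a b·A_2∧B_1 + (a−b)·I∧A_2∧B_2`. -/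
theorem statement14 (k V : Type*) [Field k] [CharZero k]
    [CommRing V] [Algebra k V]
    (a b : ℤ) (ha : 0 ≤ a) (hb : 0 ≤ b)
    (A₁ A₂ B₁ B₂ : Op V)
    (hA₁ : MemADer k a A₁) (hA₂ : MemADer k (a - 1) A₂)
    (hB₁ : MemADer k b B₁) (hB₂ : MemADer k (b - 1) B₂) :
    nrBracket a b (A₁ + wedge 1 (ar (a - 1)) Iop A₂)
        (B₁ + wedge 1 (ar (b - 1)) Iop B₂) =
      nrBracket a b A₁ B₁ +
      (((-1 : ℤˣ) ^ a : ℤˣ) : ℤ) •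
        wedge 1 (ar (a + b - 1)) Iop (nrBracket a (b - 1) A₁ B₂) +
      wedge 1 (ar (a + b - 1)) Iop (nrBracket (a - 1) b A₂ B₁) +
      a • wedge (ar a) (ar (b - 1)) A₁ B₂ -
      ((((-1 : ℤˣ) ^ a : ℤˣ) : ℤ) * b) • wedge (ar (a - 1)) (ar b) A₂ B₁ +
      (a - b) • wedge 1 (ar (a + b - 1)) Iop
        (wedge (ar (a - 1)) (ar (b - 1)) A₂ B₂) := by
  lift a to ℕ using ha
  lift b to ℕ using hb
  have htf : IsAddTorsionFree V := by
    let : Module ℚ V := Module.compHom V (algebraMap ℚ k)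
    exact .of_module_rat V
  have ha : ar (a : ℤ) = a + 1 := by unfold ar; omega
  have ha' : ar ((a : ℤ) - 1) = a := by unfold ar; omega
  have hb : ar (b : ℤ) = b + 1 := by unfold ar; omega
  have hb' : ar ((b : ℤ) - 1) = b := by unfold ar; omega
  have hab : ar ((a : ℤ) + b - 1) = a + b := by unfold ar; omega
  simp only [MemADer, ha, ha', hb, hb'] at hA₁ hA₂ hB₁ hB₂
  have hadd : ∀ {n : ℕ} {A : Op V}, IsMultilinearOn k n A → 0 < n →
      ∀ (v w : V) (x : ℕ → V), A (consV (v + w) x) = A (consV v x) + A (consV w x) := by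
    rintro (_ | n) A hA hn
    · exact absurd hn (lt_irrefl 0)
    · exact hA.consV_add
  have sA₁ := hA₁.1.isSkew hA₁.2.1
  have sA₂ := hA₂.1.isSkew hA₂.2.1
  have sB₁ := hB₁.1.isSkew hB₁.2.1
  have sB₂ := hB₂.1.isSkew hB₂.2.1
  have hAB := nrIns_splitting sA₁ hA₁.1.isOddOn hA₁.1.consV_add (hA₁.2.2 (by omega))
    sA₂ hA₂.1.isOddOn (hadd hA₂.1) (fun h => hA₂.2.2 (by omega)) sB₁ sB₂
  have hBA := nrIns_splitting sB₁ hB₁.1.isOddOn hB₁.1.consV_add (hB₁.2.2 (by omega))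
    sB₂ hB₂.1.isOddOn (hadd hB₂.1) (fun h => hB₂.2.2 (by omega)) sA₁ sA₂
  rw [wedge_comm sA₂ sB₁, wedge_comm sA₁ sB₂, wedge_comm sA₂ sB₂, wedge_zsmul_right,
    Nat.add_comm b a, Nat.mul_comm b a] at hBA
  have e₀ : ((-1 : ℤˣ) ^ ((a : ℤ) * b)) = (-1) ^ (a * b) := by
    rw [← Nat.cast_mul, zpow_natCast]
  have e₁ : ((-1 : ℤˣ) ^ ((a : ℤ) * (b - 1))) = (-1) ^ (a * b) * (-1) ^ a := by
    rw [mul_sub_one, zpow_sub, e₀, zpow_natCast, ← inv_pow, inv_neg_one]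
  have e₂ : ((-1 : ℤˣ) ^ (((a : ℤ) - 1) * b)) = (-1) ^ (a * b) * (-1) ^ b := by
    rw [sub_one_mul, zpow_sub, e₀, zpow_natCast, ← inv_pow, inv_neg_one]
  simp only [nrBracket, ha, ha', hb, hb', hab, hAB, hBA, e₀, e₁, e₂, zpow_natCast,
    wedge_add_right, wedge_neg_right, wedge_zsmul_right, Units.val_mul, Units.val_pow_eq_pow_val,
    Units.val_neg, Units.val_one, mul_add_one, add_one_mul, pow_add, Nat.mul_comm b a]
  rcases neg_one_pow_eq_or ℤ a with hs | hs <;> rcases neg_one_pow_eq_or ℤ b with ht | ht <;>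
    rcases neg_one_pow_eq_or ℤ (a * b) with hu | hu <;> rw [hs, ht, hu] <;> module

end JacobiRevisited
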